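/- Let R: C̃ → C be a Frobenius extension of abelian categories with enough projectives, with left adjoint I and right adjoint C', and suppose both C and C̃ are naively Gorenstein. Then for every object X of C̃, Gd_{C̃} X = Gd_C (R X); in particular X is Gorenstein projective in C̃ if and only if R X is Gorenstein projective in C. Moreover, if the global dimension of C is d (so every object of C has projective dimension ≤ d and Gorenstein projectives in C are projective), then Gd_{C̃} X = pd_C (R X) for every X in C̃. -/

import Mathlib

open CategoryTheory CategoryTheory.Limits

universe w w' v v' u u'

section Defs

variable {C : Type u} [Category.{v} C] [Abelian C]

/-- `f`, `g` form a short exact sequence `0 → X → Y → Z → 0`. -/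
def IsSES {X Y Z : C} (f : X ⟶ Y) (g : Y ⟶ Z) : Prop :=
  ∃ w : f ≫ g = 0, (ShortComplex.mk f g w).ShortExact

/-- Vanishing of the Yoneda Ext¹ group: every short exact sequence
`0 → P → E → Z → 0` splits. -/
def YonedaExt1Zero (Z P : C) : Prop :=
  ∀ (E : C) (i : P ⟶ E) (p : E ⟶ Z), IsSES i p → ∃ s : Z ⟶ E, s ≫ p = 𝟙 Z

/-- A totally acyclic complex of projectives: an exact complex of projective
objects which stays exact after applying `Hom(-, Q)` for every projective `Q`. -/
structure IsTotallyAcyclic (P : ChainComplex C ℤ) : Prop where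
  projective : ∀ i, Projective (P.X i)
  acyclic : ∀ i, P.ExactAt i
  homExact : ∀ (Q : C), Projective Q → ∀ (i : ℤ) (f : P.X i ⟶ Q),
    P.d (i + 1) i ≫ f = 0 → ∃ g : P.X (i - 1) ⟶ Q, P.d i (i - 1) ≫ g = f

/-- An object is Gorenstein projective if it is (isomorphic to) a syzygy of a
totally acyclic complex of projectives. -/
def IsGorensteinProjective (X : C) : Prop :=
  ∃ P : ChainComplex C ℤ, IsTotallyAcyclic P ∧ Nonempty (X ≅ cokernel (P.d 1 0))

/-- `X` admits a resolution of length at most `n` by objects satisfying `S`. -/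
inductive HasResDimLE (S : C → Prop) : C → ℕ → Prop
  | of_mem {X : C} (hX : S X) (n : ℕ) : HasResDimLE S X n
  | step {X K G : C} (n : ℕ) (f : K ⟶ G) (g : G ⟶ X)
      (hses : IsSES f g) (hG : S G) (hK : HasResDimLE S K n) :
      HasResDimLE S X (n + 1)

/-- The G-dimension: the minimal length of a Gorenstein projective resolution. -/
noncomputable def gDim (X : C) : ℕ∞ :=
  sInf {n : ℕ∞ | ∃ m : ℕ, n = (m : ℕ∞) ∧ HasResDimLE IsGorensteinProjective X m}

variable [HasExt.{w} C]

/-- The projective dimension: the minimal `m` such that `Ext^j(X, -)` vanishes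
for all `j > m`. -/
noncomputable def projDim (X : C) : ℕ∞ :=
  sInf {n : ℕ∞ | ∃ m : ℕ, n = (m : ℕ∞) ∧
    ∀ (Y : C) (j : ℕ), m < j → Subsingleton (Abelian.Ext X Y j)}

/-- The injective dimension: the minimal `m` such that `Ext^j(-, X)` vanishes
for all `j > m`. -/
noncomputable def injDim (X : C) : ℕ∞ :=
  sInf {n : ℕ∞ | ∃ m : ℕ, n = (m : ℕ∞) ∧
    ∀ (Y : C) (j : ℕ), m < j → Subsingleton (Abelian.Ext Y X j)}

end Defs

section Auxiliary

variable {C : Type u} [Category.{v} C] [Abelian C]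

lemma IsSES.mono {X Y Z : C} {f : X ⟶ Y} {g : Y ⟶ Z} (h : IsSES f g) : Mono f :=
  h.choose_spec.mono_f

lemma IsSES.epi {X Y Z : C} {f : X ⟶ Y} {g : Y ⟶ Z} (h : IsSES f g) : Epi g :=
  h.choose_spec.epi_g

lemma IsSES.zero {X Y Z : C} {f : X ⟶ Y} {g : Y ⟶ Z} (h : IsSES f g) : f ≫ g = 0 :=
  h.choose

lemma IsSES.exists_desc {X Y Z : C} {f : X ⟶ Y} {g : Y ⟶ Z} (h : IsSES f g)
    {T : C} (φ : Y ⟶ T) (hφ : f ≫ φ = 0) : ∃ ψ : Z ⟶ T, g ≫ ψ = φ :=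
  have : Epi (ShortComplex.mk f g h.zero).g := h.epi
  ⟨h.choose_spec.exact.desc φ hφ, h.choose_spec.exact.g_desc φ hφ⟩

lemma IsSES.exists_lift {X Y Z : C} {f : X ⟶ Y} {g : Y ⟶ Z} (h : IsSES f g)
    {T : C} (φ : T ⟶ Y) (hφ : φ ≫ g = 0) : ∃ ψ : T ⟶ X, ψ ≫ f = φ :=
  have : Mono (ShortComplex.mk f g h.zero).f := h.mono
  ⟨h.choose_spec.exact.lift φ hφ, h.choose_spec.exact.lift_f φ hφ⟩

lemma IsSES.of_exists_desc {X Y Z : C} {f : X ⟶ Y} {g : Y ⟶ Z} (hf : Mono f) (hg : Epi g)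
    (w : f ≫ g = 0)
    (h : ∀ (T : C) (φ : Y ⟶ T), f ≫ φ = 0 → ∃ ψ : Z ⟶ T, g ≫ ψ = φ) : IsSES f g :=
  ⟨w, { mono_f := hf
        epi_g := hg
        exact := ShortComplex.exact_of_g_is_cokernel _
          (CokernelCofork.IsColimit.ofπ g w (fun φ hφ => (h _ φ hφ).choose)
            (fun φ hφ => (h _ φ hφ).choose_spec)
            (fun φ hφ m hm => by rw [← cancel_epi g, hm, (h _ φ hφ).choose_spec])) }⟩

lemma IsSES.of_mono {X Y : C} (f : X ⟶ Y) [Mono f] : IsSES f (cokernel.π f) :=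
  .of_exists_desc inferInstance inferInstance (cokernel.condition f)
    fun _ φ hφ => ⟨cokernel.desc f φ hφ, cokernel.π_desc f φ hφ⟩

lemma IsSES.of_epi {X Y : C} (g : X ⟶ Y) [Epi g] : IsSES (kernel.ι g) g :=
  ⟨kernel.condition g, { exact := ShortComplex.exact_kernel g }⟩

lemma IsSES.exists_projective [EnoughProjectives C] (X : C) :
    ∃ (K P : C) (f : K ⟶ P) (g : P ⟶ X), Projective P ∧ IsSES f g :=
  ⟨_, _, _, _, inferInstance, .of_epi (Projective.π X)⟩

lemma IsSES.map {D : Type u'} [Category.{v'} D] [Abelian D] (F : C ⥤ D) [F.Additive]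
    [PreservesFiniteLimits F] [PreservesFiniteColimits F]
    {X Y Z : C} {f : X ⟶ Y} {g : Y ⟶ Z} (h : IsSES f g) : IsSES (F.map f) (F.map g) :=
  ⟨by rw [← F.map_comp, h.zero, F.map_zero], h.choose_spec.map_of_exact F⟩

/-- The cobase change of a short exact sequence along the kernel of another one. -/
lemma IsSES.exists_pushout {A B Q A' Q' : C} {i : A ⟶ B} {p : B ⟶ Q} {f : A ⟶ A'} {q : A' ⟶ Q'}
    (h : IsSES i p) (h' : IsSES f q) :
    ∃ (M : C) (f' : B ⟶ M) (i' : A' ⟶ M) (p' : M ⟶ Q) (q' : M ⟶ Q'),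
      IsSES i' p' ∧ IsSES f' q' := by
  have := h.mono
  have := h'.mono
  have := h.epi
  have := h'.epi
  have hp : pushout.inl i f ≫ pushout.desc p 0 (by simp [h.zero]) = p :=
    pushout.inl_desc _ _ _
  have hq : pushout.inr i f ≫ pushout.desc 0 q (by simp [h'.zero]) = q :=
    pushout.inr_desc _ _ _
  refine ⟨pushout i f, pushout.inl i f, pushout.inr i f, pushout.desc p 0 (by simp [h.zero]),
    pushout.desc 0 q (by simp [h'.zero]),
    .of_exists_desc inferInstance (epi_of_epi_fac hp) (pushout.inr_desc _ _ _) fun T φ hφ => ?_,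
    .of_exists_desc inferInstance (epi_of_epi_fac hq) (pushout.inl_desc _ _ _) fun T φ hφ => ?_⟩
  · obtain ⟨ψ, hψ⟩ := h.exists_desc (pushout.inl i f ≫ φ)
      (by rw [pushout.condition_assoc, hφ, comp_zero])
    exact ⟨ψ, pushout.hom_ext (by rw [pushout.inl_desc_assoc, hψ])
      (by rw [pushout.inr_desc_assoc, hφ, zero_comp])⟩
  · obtain ⟨ψ, hψ⟩ := h'.exists_desc (pushout.inr i f ≫ φ)
      (by rw [← pushout.condition_assoc, hφ, comp_zero])
    exact ⟨ψ, pushout.hom_ext (by rw [pushout.inl_desc_assoc, hφ, zero_comp])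
      (by rw [pushout.inr_desc_assoc, hψ])⟩

/-- The cokernel of a composite of monomorphisms is an extension of the cokernels. -/
lemma IsSES.exists_comp {A B Q Y F : C} {i : A ⟶ B} {p : B ⟶ Q} {j : B ⟶ Y} {q : Y ⟶ F}
    (h : IsSES i p) (h' : IsSES j q) :
    ∃ (N : C) (n : Y ⟶ N) (a : Q ⟶ N) (b : N ⟶ F), IsSES (i ≫ j) n ∧ IsSES a b := by
  have := h.mono
  have := h'.mono
  have := h.epi
  have := h'.epi
  have hn := IsSES.of_mono (i ≫ j)
  obtain ⟨a, ha⟩ := h.exists_desc (j ≫ cokernel.π (i ≫ j))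
    (by rw [← Category.assoc, hn.zero])
  obtain ⟨b, hb⟩ := hn.exists_desc q (by rw [Category.assoc, h'.zero, comp_zero])
  refine ⟨_, _, a, b, hn, .of_exists_desc ?_ (epi_of_epi_fac hb) ?_ fun T φ hφ => ?_⟩
  · refine Preadditive.mono_of_cancel_zero _ fun {T} x hx => ?_
    obtain ⟨T', π, _, y, hy⟩ := surjective_up_to_refinements_of_epi p x
    obtain ⟨z, hz⟩ := hn.exists_lift (y ≫ j)
      (by rw [Category.assoc, ← ha, ← Category.assoc, ← hy, Category.assoc, hx, comp_zero])
    rw [← Category.assoc, cancel_mono] at hz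
    rw [← cancel_epi π, hy, ← hz, Category.assoc, h.zero, comp_zero, comp_zero]
  · rw [← cancel_epi p, ← Category.assoc, ha, Category.assoc, hb, h'.zero, comp_zero]
  · obtain ⟨ψ, hψ⟩ := h'.exists_desc (cokernel.π (i ≫ j) ≫ φ)
      (by rw [← Category.assoc, ← ha, Category.assoc, hφ, comp_zero])
    exact ⟨ψ, by rw [← cancel_epi (cokernel.π (i ≫ j)), ← Category.assoc, hb, hψ]⟩

lemma IsSES.biprod_lift {P M B P' B' : C} {i : P ⟶ M} {q : M ⟶ B} {b : B ⟶ P'} {c : P' ⟶ B'}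
    (h : IsSES i q) (h' : IsSES b c) {s : M ⟶ P} (hs : i ≫ s = 𝟙 P) :
    IsSES (biprod.lift s (q ≫ b)) (biprod.snd ≫ c) := by
  have := h'.mono
  have := h.epi
  have := h'.epi
  refine .of_exists_desc ?_ inferInstance (by simp [h'.zero]) fun T φ hφ => ?_
  · refine Preadditive.mono_of_cancel_zero _ fun {T} x hx => ?_
    have h₁ : x ≫ s = 0 := by simpa using hx =≫ biprod.fst
    have h₂ : (x ≫ q) ≫ b = 0 := by simpa using hx =≫ biprod.snd
    obtain ⟨y, hy⟩ := h.exists_lift x (zero_of_comp_mono b h₂)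
    rw [← hy, Category.assoc, hs, Category.comp_id] at h₁
    rw [← hy, h₁, zero_comp]
  · rw [biprod.lift_eq, Preadditive.add_comp] at hφ
    simp only [Category.assoc] at hφ
    have h₁ : biprod.inl ≫ φ = 0 := by
      have := i ≫= hφ
      rw [Preadditive.comp_add, ← Category.assoc i s, hs, ← Category.assoc i q, h.zero] at this
      simpa using this
    have h₂ : b ≫ biprod.inr ≫ φ = 0 := by
      rw [h₁, comp_zero, zero_add] at hφ
      exact zero_of_epi_comp q hφ
    obtain ⟨ψ, hψ⟩ := h'.exists_desc _ h₂
    refine ⟨ψ, biprod.hom_ext' _ _ (by simp [h₁]) (by simp [hψ])⟩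

lemma IsSES.exact_comp {W X Y Z V : C} {f : X ⟶ Y} {g : Y ⟶ Z} (h : IsSES f g)
    (e : W ⟶ X) (m : Z ⟶ V) [Epi e] [Mono m] (w : (e ≫ f) ≫ g ≫ m = 0) :
    (ShortComplex.mk (e ≫ f) (g ≫ m) w).Exact := by
  rw [ShortComplex.exact_iff_exact_up_to_refinements]
  intro T x hx
  dsimp at x hx
  rw [← Category.assoc] at hx
  obtain ⟨y, hy⟩ := h.exists_lift x (zero_of_comp_mono m hx)
  obtain ⟨T', π, hπ, z, hz⟩ := surjective_up_to_refinements_of_epi e y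
  exact ⟨T', π, hπ, z, by
    dsimp
    rw [← hy, ← Category.assoc, hz, Category.assoc]⟩

/-- `K` is the kernel of an epimorphism from a projective object onto `Y`, and every
morphism from `K` to a projective object extends along `K ⟶ P`. -/
def IsProjSyzygy (K Y : C) : Prop :=
  ∃ (P : C) (f : K ⟶ P) (g : P ⟶ Y), Projective P ∧ IsSES f g ∧
    ∀ Q : C, Projective Q → ∀ h : K ⟶ Q, ∃ h' : P ⟶ Q, f ≫ h' = h

lemma IsProjSyzygy.of_iso_left {K K' Y : C} (h : IsProjSyzygy K Y) (e : K' ≅ K) :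
    IsProjSyzygy K' Y := by
  obtain ⟨P, f, g, hP, hses, hext⟩ := h
  have := hses.mono
  refine ⟨P, e.hom ≫ f, g, hP, .of_exists_desc inferInstance hses.epi
    (by rw [Category.assoc, hses.zero, comp_zero]) fun T φ hφ => hses.exists_desc φ ?_,
    fun Q hQ k => ?_⟩
  · rwa [Category.assoc, ← cancel_epi e.inv, e.inv_hom_id_assoc, comp_zero] at hφ
  · obtain ⟨h', hh'⟩ := hext Q hQ (e.inv ≫ k)
    exact ⟨h', by rw [Category.assoc, hh', e.hom_inv_id_assoc]⟩

lemma IsProjSyzygy.of_iso_right {K Y Y' : C} (h : IsProjSyzygy K Y) (e : Y ≅ Y') :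
    IsProjSyzygy K Y' := by
  obtain ⟨P, f, g, hP, hses, hext⟩ := h
  have := hses.epi
  refine ⟨P, f, g ≫ e.hom, hP, .of_exists_desc hses.mono inferInstance
    (by rw [← Category.assoc, hses.zero, zero_comp]) fun T φ hφ => ?_, hext⟩
  obtain ⟨ψ, hψ⟩ := hses.exists_desc φ hφ
  exact ⟨e.inv ≫ ψ, by simp [hψ]⟩

lemma isGorensteinProjective_iff (Y : C) :
    IsGorensteinProjective Y ↔
      ∃ Z : ℤ → C, Nonempty (Y ≅ Z 0) ∧ ∀ i, IsProjSyzygy (Z (i + 1)) (Z i) := by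
  constructor
  · rintro ⟨P, hP, ⟨e⟩⟩
    refine ⟨fun i => cokernel (P.d (i + 1) i), by beta_reduce; rw [zero_add]; exact ⟨e⟩, fun i => ?_⟩
    refine ⟨P.X i, cokernel.desc _ (P.d (i + 1) i) (P.d_comp_d _ _ _), cokernel.π _,
      hP.projective i, .of_exists_desc ?_ inferInstance ?_ fun T φ hφ => ?_, fun Q hQ h => ?_⟩
    · have hex := (P.exactAt_iff' (i + 1 + 1) (i + 1) i (by simp) (by simp)).1
        (hP.acyclic (i + 1))
      exact hex.mono_cokernelDesc
    · rw [← cancel_epi (cokernel.π _)]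
      simp
    · have h₀ : P.d (i + 1) i ≫ φ = 0 := by
        have := cokernel.π (P.d (i + 1 + 1) (i + 1)) ≫= hφ
        simpa using this
      exact ⟨cokernel.desc _ φ h₀, cokernel.π_desc _ _ _⟩
    · have H := hP.homExact Q hQ (i + 1) (cokernel.π _ ≫ h) (by simp)
      rw [add_sub_cancel_right] at H
      obtain ⟨g, hg⟩ := H
      exact ⟨g, by rw [← cancel_epi (cokernel.π _)]; simp [hg]⟩
  · rintro ⟨Z, ⟨e⟩, hZ⟩
    choose P f g hP hses hext using hZ
    have hf := fun i => (hses i).mono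
    have hg := fun i => (hses i).epi
    have sq : ∀ i, (g (i + 1 + 1) ≫ f (i + 1)) ≫ g (i + 1) ≫ f i = 0 := fun i => by
      rw [Category.assoc, ← Category.assoc (f (i + 1)), (hses (i + 1)).zero, zero_comp, comp_zero]
    let K := ChainComplex.of P (fun i => g (i + 1) ≫ f i) sq
    have hd : ∀ i, K.d (i + 1) i = g (i + 1) ≫ f i := fun i =>
      ChainComplex.of_d P (fun i => g (i + 1) ≫ f i) i
    refine ⟨K, ⟨hP, fun i => ?_, fun Q hQ i h hh => ?_⟩, ⟨e ≪≫ ?_⟩⟩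
    · obtain ⟨k, rfl⟩ : ∃ k, i = k + 1 := ⟨i - 1, by ring⟩
      rw [K.exactAt_iff' (k + 1 + 1) (k + 1) k (by simp) (by simp)]
      have := (hses (k + 1)).exact_comp (g (k + 1 + 1)) (f k) (sq k)
      convert this using 1
      simp only [HomologicalComplex.sc', HomologicalComplex.shortComplexFunctor', hd]
    · obtain ⟨k, rfl⟩ : ∃ k, i = k + 1 := ⟨i - 1, by ring⟩
      rw [add_sub_cancel_right]
      rw [hd, Category.assoc] at hh
      obtain ⟨ψ, hψ⟩ := (hses (k + 1)).exists_desc h (zero_of_epi_comp _ hh)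
      obtain ⟨ψ', hψ'⟩ := hext k Q hQ ψ
      exact ⟨ψ', by rw [hd, Category.assoc, hψ', hψ]⟩
    · have : Epi (ShortComplex.mk (f 0) (g 0) (hses 0).zero).g := hg 0
      exact (IsColimit.coconePointUniqueUpToIso (hses 0).choose_spec.exact.gIsCokernel
          (cokernelIsCokernel (f 0))) ≪≫ (cokernelEpiComp (g (0 + 1)) (f 0)).symm ≪≫
        cokernelIsoOfEq (hd 0).symm

lemma IsGorensteinProjective.exists_cosyzygy {Y : C} (h : IsGorensteinProjective Y) :
    ∃ Y', IsGorensteinProjective Y' ∧ IsProjSyzygy Y Y' := by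
  obtain ⟨Z, ⟨e⟩, hZ⟩ := (isGorensteinProjective_iff Y).1 h
  refine ⟨Z (-1), (isGorensteinProjective_iff _).2 ⟨fun i => Z (i - 1), ⟨Iso.refl _⟩, fun i => ?_⟩,
    (hZ (-1)).of_iso_left e⟩
  have := hZ (i - 1)
  rwa [show i - 1 + 1 = i + 1 - 1 by ring] at this

lemma IsGorensteinProjective.exists_syzygy {Y : C} (h : IsGorensteinProjective Y) :
    ∃ K, IsGorensteinProjective K ∧ IsProjSyzygy K Y := by
  obtain ⟨Z, ⟨e⟩, hZ⟩ := (isGorensteinProjective_iff Y).1 h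
  exact ⟨Z (0 + 1), (isGorensteinProjective_iff _).2
    ⟨fun i => Z (i + 1), ⟨Iso.refl _⟩, fun i => hZ (i + 1)⟩, (hZ 0).of_iso_right e.symm⟩

/-- Coinduction principle for Gorenstein projective objects. -/
lemma IsGorensteinProjective.of_coinduction (S : C → Prop)
    (hl : ∀ Y, S Y → ∃ K, S K ∧ IsProjSyzygy K Y)
    (hr : ∀ Y, S Y → ∃ Y', S Y' ∧ IsProjSyzygy Y Y') {Y : C} (hY : S Y) :
    IsGorensteinProjective Y := by
  choose! l hlS hl using hl
  choose! r hrS hr using hr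
  have hlY : ∀ n, S (l^[n] Y) := fun n => by
    induction n with
    | zero => exact hY
    | succ n ih => rw [Function.iterate_succ_apply']; exact hlS _ ih
  have hrY : ∀ n, S (r^[n] Y) := fun n => by
    induction n with
    | zero => exact hY
    | succ n ih => rw [Function.iterate_succ_apply']; exact hrS _ ih
  let Z : ℤ → C := fun i => match i with
    | .ofNat n => l^[n] Y
    | .negSucc n => r^[n + 1] Y
  refine (isGorensteinProjective_iff Y).2 ⟨Z, ⟨Iso.refl _⟩, fun i => ?_⟩
  match i with
  | .ofNat n =>
    change IsProjSyzygy (l^[n + 1] Y) (l^[n] Y)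
    rw [Function.iterate_succ_apply']
    exact hl _ (hlY n)
  | .negSucc 0 => exact hr _ hY
  | .negSucc (n + 1) =>
    change IsProjSyzygy (r^[n + 1] Y) (r^[n + 1 + 1] Y)
    rw [Function.iterate_succ_apply' r (n + 1)]
    exact hr _ (hrY (n + 1))

lemma exists_hasResDimLE_of_gDim_ne_top {X : C} (h : gDim X ≠ ⊤) :
    ∃ n, HasResDimLE IsGorensteinProjective X n := by
  by_contra! hn
  refine h (sInf_eq_top.2 ?_)
  rintro _ ⟨m, -, hm⟩
  exact absurd hm (hn m)

section Ext

open Abelian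

variable [HasExt.{w} C]

lemma IsSES.ext_subsingleton₂ {X Y Z : C} {f : X ⟶ Y} {g : Y ⟶ Z} (h : IsSES f g) (Q : C) (j : ℕ)
    (h₁ : Subsingleton (Ext X Q j)) (h₃ : Subsingleton (Ext Z Q j)) :
    Subsingleton (Ext Y Q j) := by
  refine subsingleton_of_forall_eq 0 fun x => ?_
  obtain ⟨y, rfl⟩ := Ext.contravariant_sequence_exact₂ h.choose_spec Q x (Subsingleton.elim _ _)
  rw [Subsingleton.elim (α := Ext Z Q j) y 0, Ext.comp_zero]

lemma IsSES.ext_subsingleton₁ {X Y Z : C} {f : X ⟶ Y} {g : Y ⟶ Z} (h : IsSES f g) (Q : C) (j : ℕ)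
    (h₂ : Subsingleton (Ext Y Q j)) (h₃ : Subsingleton (Ext Z Q (j + 1))) :
    Subsingleton (Ext X Q j) := by
  refine subsingleton_of_forall_eq 0 fun x => ?_
  obtain ⟨y, rfl⟩ := Ext.contravariant_sequence_exact₁ h.choose_spec Q x (add_comm 1 j)
    (Subsingleton.elim _ _)
  rw [Subsingleton.elim (α := Ext Y Q j) y 0, Ext.comp_zero]

lemma IsSES.ext_subsingleton₃ {X Y Z : C} {f : X ⟶ Y} {g : Y ⟶ Z} (h : IsSES f g) (Q : C) (j : ℕ)
    (h₁ : Subsingleton (Ext X Q j)) (h₂ : Subsingleton (Ext Y Q (j + 1))) :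
    Subsingleton (Ext Z Q (j + 1)) := by
  refine subsingleton_of_forall_eq 0 fun x => ?_
  obtain ⟨y, rfl⟩ := Ext.contravariant_sequence_exact₃ h.choose_spec Q x
    (Subsingleton.elim _ _) (add_comm 1 j)
  rw [Subsingleton.elim (α := Ext X Q j) y 0, Ext.comp_zero]

lemma IsSES.exists_extension {X Y Z : C} {f : X ⟶ Y} {g : Y ⟶ Z} (h : IsSES f g) {Q : C}
    (hQ : Subsingleton (Ext Z Q 1)) (k : X ⟶ Q) : ∃ k' : Y ⟶ Q, f ≫ k' = k := by
  obtain ⟨y, hy⟩ := Ext.contravariant_sequence_exact₁ h.choose_spec Q (Ext.mk₀ k) (add_zero 1)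
    (Subsingleton.elim _ _)
  obtain ⟨k', rfl⟩ := Ext.mk₀_bijective _ _ |>.2 y
  rw [Ext.mk₀_comp_mk₀] at hy
  exact ⟨k', (Ext.mk₀_bijective _ _).1 hy⟩

lemma ext_subsingleton_of_projective (P Q : C) [Projective P] (j : ℕ) :
    Subsingleton (Ext P Q (j + 1)) :=
  subsingleton_of_forall_eq 0 fun x => x.eq_zero_of_projective

lemma IsSES.ext_one_subsingleton {X Y Z : C} {f : X ⟶ Y} {g : Y ⟶ Z} (h : IsSES f g) {Q : C}
    [Projective Y] (hQ : ∀ k : X ⟶ Q, ∃ k' : Y ⟶ Q, f ≫ k' = k) : Subsingleton (Ext Z Q 1) := by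
  refine subsingleton_of_forall_eq 0 fun x => ?_
  obtain ⟨y, rfl⟩ := Ext.contravariant_sequence_exact₃ h.choose_spec Q x
    (Ext.eq_zero_of_projective _) (add_zero 1)
  obtain ⟨k, rfl⟩ := Ext.mk₀_bijective _ _ |>.2 y
  obtain ⟨k', rfl⟩ := hQ k
  rw [← Ext.mk₀_comp_mk₀, ← Ext.comp_assoc _ _ _ (add_zero 1) (zero_add 0) (by simp),
    h.choose_spec.extClass_comp, Ext.zero_comp]

lemma ext_subsingleton_of_retract {X P P' : C} (s : P ⟶ P') (p : P' ⟶ P) (hsp : s ≫ p = 𝟙 P)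
    (j : ℕ) (h : Subsingleton (Ext X P' j)) : Subsingleton (Ext X P j) := by
  refine subsingleton_of_forall_eq 0 fun x => ?_
  rw [← x.comp_mk₀_id, ← hsp, ← Ext.mk₀_comp_mk₀,
    ← Ext.comp_assoc _ _ _ (add_zero j) (zero_add 0) (by simp),
    Subsingleton.elim (x.comp (Ext.mk₀ s) (add_zero j)) 0, Ext.zero_comp]

/-- `Ext^j(X, Q)` vanishes for all `j > n` and all projective `Q`. -/
def ExtVanishesAbove (n : ℕ) (X : C) : Prop :=
  ∀ (Q : C), Projective Q → ∀ j, n < j → Subsingleton (Ext X Q j)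

lemma extVanishesAbove_of_projective (P : C) [Projective P] (n : ℕ) : ExtVanishesAbove n P := by
  intro Q _ j hj
  obtain ⟨j, rfl⟩ := Nat.exists_eq_succ_of_ne_zero (Nat.ne_zero_of_lt hj)
  exact ext_subsingleton_of_projective P Q j

lemma IsSES.isProjSyzygy {X Y Z : C} {f : X ⟶ Y} {g : Y ⟶ Z} (h : IsSES f g)
    (hY : Projective Y) (hZ : ExtVanishesAbove 0 Z) : IsProjSyzygy X Z :=
  ⟨Y, f, g, hY, h, fun Q hQ => h.exists_extension (hZ Q hQ 1 one_pos)⟩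

lemma IsSES.extVanishesAbove₁ {X Y Z : C} {f : X ⟶ Y} {g : Y ⟶ Z} (h : IsSES f g) {n : ℕ}
    (hY : ExtVanishesAbove n Y) (hZ : ExtVanishesAbove (n + 1) Z) : ExtVanishesAbove n X :=
  fun Q hQ j hj => h.ext_subsingleton₁ Q j (hY Q hQ j hj) (hZ Q hQ (j + 1) (by lia))

lemma IsSES.extVanishesAbove₂ {X Y Z : C} {f : X ⟶ Y} {g : Y ⟶ Z} (h : IsSES f g) {n : ℕ}
    (hX : ExtVanishesAbove n X) (hZ : ExtVanishesAbove n Z) : ExtVanishesAbove n Y :=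
  fun Q hQ j hj => h.ext_subsingleton₂ Q j (hX Q hQ j hj) (hZ Q hQ j hj)

lemma IsSES.extVanishesAbove₃ {X Y Z : C} {f : X ⟶ Y} {g : Y ⟶ Z} (h : IsSES f g) {n : ℕ}
    (hX : ExtVanishesAbove n X) (hY : ExtVanishesAbove (n + 1) Y) :
    ExtVanishesAbove (n + 1) Z := by
  intro Q hQ j hj
  obtain ⟨j, rfl⟩ := Nat.exists_eq_succ_of_ne_zero (Nat.ne_zero_of_lt hj)
  exact h.ext_subsingleton₃ Q j (hX Q hQ j (by lia)) (hY Q hQ (j + 1) hj)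

lemma ExtVanishesAbove.mono {n m : ℕ} (hnm : n ≤ m) {X : C} (h : ExtVanishesAbove n X) :
    ExtVanishesAbove m X :=
  fun Q hQ j hj => h Q hQ j (by lia)

lemma IsProjSyzygy.extVanishesAbove_syzygy {K Y : C} (h : IsProjSyzygy K Y)
    (hY : ExtVanishesAbove 0 Y) : ExtVanishesAbove 0 K := by
  obtain ⟨P, f, g, hP, hses, -⟩ := h
  exact hses.extVanishesAbove₁ (extVanishesAbove_of_projective P 0) (hY.mono (Nat.zero_le _))

lemma IsProjSyzygy.extVanishesAbove_cosyzygy {K Y : C} (h : IsProjSyzygy K Y)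
    (hK : ExtVanishesAbove 0 K) : ExtVanishesAbove 0 Y := by
  obtain ⟨P, f, g, hP, hses, hext⟩ := h
  intro Q hQ j hj
  match j with
  | 1 => exact hses.ext_one_subsingleton (hext Q hQ)
  | j + 2 => exact hses.extVanishesAbove₃ hK (extVanishesAbove_of_projective P 1) Q hQ _ (by lia)

lemma IsGorensteinProjective.extVanishesAbove {Y : C} (h : IsGorensteinProjective Y) :
    ExtVanishesAbove 0 Y := by
  intro Q hQ j hj
  obtain ⟨j, rfl⟩ := Nat.exists_eq_succ_of_ne_zero hj.ne'
  clear hj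
  induction j generalizing Y with
  | zero =>
    obtain ⟨K, -, P, f, g, hP, hses, hext⟩ := h.exists_syzygy
    exact hses.ext_one_subsingleton (hext Q hQ)
  | succ j ih =>
    obtain ⟨K, hK, P, f, g, hP, hses, -⟩ := h.exists_syzygy
    exact hses.ext_subsingleton₃ Q _ (ih hK) (ext_subsingleton_of_projective _ _ _)

lemma HasResDimLE.extVanishesAbove {X : C} {n : ℕ}
    (h : HasResDimLE IsGorensteinProjective X n) : ExtVanishesAbove n X := by
  induction h with
  | of_mem hX n => exact hX.extVanishesAbove.mono (Nat.zero_le _)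
  | step n f g hses hG _ ih =>
    exact hses.extVanishesAbove₃ ih (hG.extVanishesAbove.mono (Nat.zero_le _))

lemma HasResDimLE.projective_of_extVanishesAbove {X : C} {n : ℕ}
    (h : HasResDimLE Projective X n) (hX : ExtVanishesAbove 0 X) : Projective X := by
  induction h with
  | of_mem hP n => exact hP
  | @step X K G n f g hses hG _ ih =>
    have hK := ih (hses.extVanishesAbove₁ (extVanishesAbove_of_projective G 0)
      (hX.mono (Nat.zero_le _)))
    obtain ⟨r, hr⟩ := hses.exists_extension (hX K hK 1 one_pos) (𝟙 K)
    obtain ⟨s, hs⟩ := hses.exists_desc (𝟙 G - r ≫ f)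
      (by rw [Preadditive.comp_sub, ← Category.assoc, hr]; simp)
    have := hses.epi
    refine Retract.projective (Y := G) ⟨s, g, ?_⟩
    rw [← cancel_epi g, ← Category.assoc, hs, Preadditive.sub_comp, Category.assoc, hses.zero]
    simp

/-- Objects obtained from objects satisfying `S` by iterated syzygies. -/
inductive IteratedProjSyzygy (S : C → Prop) : C → Prop
  | of_mem {X : C} (hX : S X) : IteratedProjSyzygy S X
  | syzygy {X K : C} (h : IsProjSyzygy K X) (hX : IteratedProjSyzygy S X) :
      IteratedProjSyzygy S K

lemma IsGorensteinProjective.of_cosyzygies [EnoughProjectives C] (S : C → Prop)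
    (hS : ∀ Y, S Y → ExtVanishesAbove 0 Y)
    (hr : ∀ Y, S Y → ∃ Y', S Y' ∧ IsProjSyzygy Y Y') {Y : C} (hY : S Y) :
    IsGorensteinProjective Y := by
  refine .of_coinduction (IteratedProjSyzygy S) (fun X hX => ?_) (fun X hX => ?_) (.of_mem hY)
  · have hv : ExtVanishesAbove 0 X := by
      induction hX with
      | of_mem hX => exact hS _ hX
      | syzygy h _ ih => exact h.extVanishesAbove_syzygy ih
    obtain ⟨K, P, f, g, hP, hses⟩ := IsSES.exists_projective X
    have := hses.isProjSyzygy hP hv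
    exact ⟨K, .syzygy this hX, this⟩
  · cases hX with
    | of_mem hX =>
      obtain ⟨Y', hY', h⟩ := hr X hX
      exact ⟨Y', .of_mem hY', h⟩
    | syzygy h hX => exact ⟨_, hX, h⟩

lemma IsGorensteinProjective.of_extension [EnoughProjectives C] {A M B : C} {i : A ⟶ M}
    {p : M ⟶ B} (h : IsSES i p) (hA : IsGorensteinProjective A) (hB : IsGorensteinProjective B) :
    IsGorensteinProjective M := by
  let S : C → Prop := fun M => ∃ (A B : C) (i : A ⟶ M) (p : M ⟶ B), IsSES i p ∧
    IsGorensteinProjective A ∧ IsGorensteinProjective B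
  have hS : ∀ Y, S Y → ExtVanishesAbove 0 Y := by
    rintro Y ⟨A, B, i, p, h, hA, hB⟩
    exact h.extVanishesAbove₂ hA.extVanishesAbove hB.extVanishesAbove
  refine .of_cosyzygies S hS ?_ ⟨A, B, i, p, h, hA, hB⟩
  rintro M ⟨A, B, i, p, h, hA, hB⟩
  obtain ⟨A', hA', P, f, q, hP, hf, -⟩ := hA.exists_cosyzygy
  obtain ⟨B', hB', P', b, c, hP', hb, -⟩ := hB.exists_cosyzygy
  obtain ⟨M', f', i', p', q', h₁, h₂⟩ := h.exists_pushout hf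
  obtain ⟨s, hs⟩ := h₁.exists_extension (hB.extVanishesAbove P hP 1 one_pos) (𝟙 P)
  obtain ⟨N, n, a, b', h₃, h₄⟩ := h₂.exists_comp (h₁.biprod_lift hb hs)
  have hN : S N := ⟨_, _, _, _, h₄, hA', hB'⟩
  exact ⟨N, hN, h₃.isProjSyzygy inferInstance (hS N hN)⟩

/-- An object of finite G-dimension embeds into an object of finite projective dimension
with Gorenstein projective cokernel. -/
lemma HasResDimLE.exists_hull [EnoughProjectives C] {X : C} {n : ℕ}
    (h : HasResDimLE IsGorensteinProjective X n) :
    ∃ (H G : C) (f : X ⟶ H) (g : H ⟶ G), IsSES f g ∧ HasResDimLE Projective H n ∧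
      IsGorensteinProjective G := by
  induction h with
  | of_mem hX n =>
    obtain ⟨G, hG, P, f, g, hP, hses, -⟩ := hX.exists_cosyzygy
    exact ⟨P, G, f, g, hses, .of_mem hP n, hG⟩
  | step n f g hses hG _ ih =>
    obtain ⟨H, G', k, l, hkl, hH, hG'⟩ := ih
    obtain ⟨M, f', i', p', q', h₁, h₂⟩ := hses.exists_pushout hkl
    have hM := IsGorensteinProjective.of_extension h₂ hG hG'
    obtain ⟨G'', hG'', P, a, b, hP, hab, -⟩ := hM.exists_cosyzygy
    obtain ⟨N, n', c, d, h₃, h₄⟩ := h₁.exists_comp hab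
    exact ⟨N, G'', c, d, h₄, .step n _ _ h₃ hP hH, hG''⟩

lemma ExtVanishesAbove.isGorensteinProjective [EnoughProjectives C]
    (hGor : ∀ X : C, gDim X ≠ ⊤) {X : C} (hX : ExtVanishesAbove 0 X) :
    IsGorensteinProjective X := by
  refine .of_cosyzygies (ExtVanishesAbove 0) (fun _ => id) (fun Y hY => ?_) hX
  obtain ⟨n, hn⟩ := exists_hasResDimLE_of_gDim_ne_top (hGor Y)
  obtain ⟨H, G, f, g, hses, hH, hG⟩ := hn.exists_hull
  have hP := hH.projective_of_extVanishesAbove (hses.extVanishesAbove₂ hY hG.extVanishesAbove)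
  exact ⟨G, hG.extVanishesAbove, hses.isProjSyzygy hP hG.extVanishesAbove⟩

/-- In a naively Gorenstein category, vanishing of `Ext` into projectives bounds the
G-dimension. -/
lemma ExtVanishesAbove.hasResDimLE [EnoughProjectives C]
    (hGor : ∀ X : C, gDim X ≠ ⊤) {X : C} {n : ℕ} (hX : ExtVanishesAbove n X) :
    HasResDimLE IsGorensteinProjective X n := by
  induction n generalizing X with
  | zero => exact .of_mem (hX.isGorensteinProjective hGor) 0
  | succ n ih =>
    obtain ⟨K, P, f, g, hP, hses⟩ := IsSES.exists_projective X
    exact .step n f g hses ((extVanishesAbove_of_projective P 0).isGorensteinProjective hGor)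
      (ih (hses.extVanishesAbove₁ (extVanishesAbove_of_projective P n) hX))

lemma subsingleton_ext_of_projDim_le {X : C} {d : ℕ} (h : projDim X ≤ (d : ℕ∞)) (Y : C) {j : ℕ}
    (hj : d < j) : Subsingleton (Ext X Y j) := by
  have hne : {n : ℕ∞ | ∃ m : ℕ, n = (m : ℕ∞) ∧
      ∀ (Y : C) (j : ℕ), m < j → Subsingleton (Ext X Y j)}.Nonempty := by
    by_contra! he
    rw [projDim, he, sInf_empty] at h
    exact ENat.natCast_ne_top d (top_le_iff.1 h)
  obtain ⟨m, hm, hX⟩ := csInf_mem hne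
  rw [projDim, hm, Nat.cast_le] at h
  exact hX Y j (by lia)

lemma IsGorensteinProjective.subsingleton_ext {d : ℕ}
    (hd : ∀ (Y Z : C) (j : ℕ), d < j → Subsingleton (Ext Y Z j))
    {X : C} (hX : IsGorensteinProjective X) (Z : C) (j : ℕ) :
    Subsingleton (Ext X Z (j + 1)) := by
  induction h : d - j generalizing X j with
  | zero => exact hd _ _ _ (by lia)
  | succ k ih =>
    obtain ⟨X', hX', P, f, g, hP, hses, -⟩ := hX.exists_cosyzygy
    exact hses.ext_subsingleton₁ Z _ (ext_subsingleton_of_projective _ _ _)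
      (ih hX' (j + 1) (by lia))

lemma HasResDimLE.subsingleton_ext {d : ℕ}
    (hd : ∀ (Y Z : C) (j : ℕ), d < j → Subsingleton (Ext Y Z j)) {X : C} {n : ℕ}
    (h : HasResDimLE IsGorensteinProjective X n) (Z : C) (j : ℕ) (hj : n < j) :
    Subsingleton (Ext X Z j) := by
  obtain ⟨j, rfl⟩ := Nat.exists_eq_succ_of_ne_zero (Nat.ne_zero_of_lt hj)
  induction h generalizing j with
  | of_mem hX n => exact hX.subsingleton_ext hd Z j
  | step n f g hses hG _ ih =>
    obtain ⟨j, rfl⟩ := Nat.exists_eq_succ_of_ne_zero (show j ≠ 0 by lia)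
    exact hses.ext_subsingleton₃ Z _ (ih _ (by lia)) (hG.subsingleton_ext hd Z _)

lemma gDim_eq_projDim [EnoughProjectives C] (hGor : ∀ X : C, gDim X ≠ ⊤) {d : ℕ}
    (hd : ∀ Y : C, projDim Y ≤ (d : ℕ∞)) (X : C) : gDim X = projDim X := by
  have hd' : ∀ (Y Z : C) (j : ℕ), d < j → Subsingleton (Ext Y Z j) :=
    fun Y Z j hj => subsingleton_ext_of_projDim_le (hd Y) Z hj
  have : ∀ m : ℕ, HasResDimLE IsGorensteinProjective X m ↔
      ∀ (Y : C) (j : ℕ), m < j → Subsingleton (Ext X Y j) := fun m =>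
    ⟨fun h => h.subsingleton_ext hd',
      fun h => ExtVanishesAbove.hasResDimLE hGor fun Q _ => h Q⟩
  simp only [gDim, projDim, this]

end Ext

section Adjunction

open Abelian

variable {D : Type u'} [Category.{v'} D] [Abelian D] {R : D ⥤ C} {Co : C ⥤ D}
  [R.Additive] [PreservesFiniteLimits R] [PreservesFiniteColimits R]

lemma IsProjSyzygy.map (adj : R ⊣ Co) [Co.PreservesEpimorphisms]
    (hCo : ∀ Q : C, Projective Q → Projective (Co.obj Q)) {K Y : D} (h : IsProjSyzygy K Y) :
    IsProjSyzygy (R.obj K) (R.obj Y) := by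
  obtain ⟨P, f, g, hP, hses, hext⟩ := h
  refine ⟨R.obj P, R.map f, R.map g, adj.map_projective P hP, hses.map R, fun Q hQ k => ?_⟩
  obtain ⟨k', hk'⟩ := hext _ (hCo Q hQ) (adj.homEquiv _ _ k)
  exact ⟨(adj.homEquiv _ _).symm k', by
    rw [← adj.homEquiv_naturality_left_symm, hk', Equiv.symm_apply_apply]⟩

lemma IsGorensteinProjective.map (adj : R ⊣ Co) [Co.PreservesEpimorphisms]
    (hCo : ∀ Q : C, Projective Q → Projective (Co.obj Q)) {X : D}
    (h : IsGorensteinProjective X) : IsGorensteinProjective (R.obj X) := by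
  refine .of_coinduction (fun Y => ∃ X, IsGorensteinProjective X ∧ R.obj X = Y) ?_ ?_ ⟨X, h, rfl⟩
  · rintro _ ⟨X, hX, rfl⟩
    obtain ⟨K, hK, hs⟩ := hX.exists_syzygy
    exact ⟨_, ⟨K, hK, rfl⟩, hs.map adj hCo⟩
  · rintro _ ⟨X, hX, rfl⟩
    obtain ⟨K, hK, hs⟩ := hX.exists_cosyzygy
    exact ⟨_, ⟨K, hK, rfl⟩, hs.map adj hCo⟩

lemma HasResDimLE.map {S : D → Prop} {T : C → Prop} (hST : ∀ X, S X → T (R.obj X)) {X : D} {n : ℕ}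
    (h : HasResDimLE S X n) : HasResDimLE T (R.obj X) n := by
  induction h with
  | of_mem hX n => exact .of_mem (hST _ hX) n
  | step n f g hses hG _ ih => exact .step n _ _ (hses.map R) (hST _ hG) ih

lemma subsingleton_ext_rightAdjoint_obj [HasExt.{w} C] [HasExt.{w'} D] [EnoughProjectives D]
    (adj : R ⊣ Co) [Co.PreservesEpimorphisms] (Q : C) (j : ℕ) (X : D)
    (h : Subsingleton (Ext (R.obj X) Q (j + 1))) : Subsingleton (Ext X (Co.obj Q) (j + 1)) := by
  induction j generalizing X with
  | zero =>
    obtain ⟨K, P, f, g, hP, hses⟩ := IsSES.exists_projective X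
    refine hses.ext_one_subsingleton fun k => ?_
    obtain ⟨k', hk'⟩ := (hses.map R).exists_extension h ((adj.homEquiv _ _).symm k)
    exact ⟨adj.homEquiv _ _ k', by
      rw [← adj.homEquiv_naturality_left, hk', Equiv.apply_symm_apply]⟩
  | succ j ih =>
    obtain ⟨K, P, f, g, hP, hses⟩ := IsSES.exists_projective X
    have := adj.map_projective P hP
    exact hses.ext_subsingleton₃ _ _
      (ih K ((hses.map R).ext_subsingleton₁ Q _ (ext_subsingleton_of_projective _ _ _) h))
      (ext_subsingleton_of_projective _ _ _)

end Adjunction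

end Auxiliary

/-- For a Frobenius extension `R : D ⥤ C` of naively Gorenstein categories
with enough projectives, G-dimensions are computed by restriction; when `C`
has global dimension `d`, the G-dimension in `D` is the projective dimension
of the restriction. -/
theorem frobenius_gdim_restriction
    {C : Type u} [Category.{v} C] [Abelian C]
    {D : Type u'} [Category.{v'} D] [Abelian D]
    [EnoughProjectives C] [EnoughProjectives D] [HasExt.{w} C]
    (R : D ⥤ C) (I Co : C ⥤ D)
    [R.Additive] [I.Additive] [Co.Additive]
    [R.Faithful] [I.Faithful] [Co.Faithful]
    (adj₁ : I ⊣ R) (adj₂ : R ⊣ Co)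
    (E : C ≌ C) (hE : I ≅ E.functor ⋙ Co)
    (hGorC : ∀ X : C, gDim X ≠ ⊤) (hGorD : ∀ X : D, gDim X ≠ ⊤) :
    (∀ X : D, gDim X = gDim (R.obj X)) ∧
    (∀ X : D, IsGorensteinProjective X ↔ IsGorensteinProjective (R.obj X)) ∧
    (∀ d : ℕ, (∀ Y : C, projDim Y ≤ (d : ℕ∞)) →
      ∀ X : D, gDim X = projDim (R.obj X)) := by
  have : R.IsLeftAdjoint := adj₂.isLeftAdjoint
  have : R.IsRightAdjoint := adj₁.isRightAdjoint
  have : I.IsLeftAdjoint := adj₁.isLeftAdjoint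
  have : PreservesFiniteLimits R := ⟨fun _ _ _ => inferInstance⟩
  have : PreservesFiniteColimits R := ⟨fun _ _ _ => inferInstance⟩
  let e : Co ≅ E.inverse ⋙ I :=
    (Functor.leftUnitor Co).symm ≪≫ Functor.isoWhiskerRight E.counitIso.symm Co ≪≫
      Functor.associator _ _ _ ≪≫ Functor.isoWhiskerLeft E.inverse hE.symm
  have : Co.PreservesEpimorphisms := Functor.PreservesEpimorphisms.of_iso e.symm
  have hCo : ∀ Q : C, Projective Q → Projective (Co.obj Q) := fun Q hQ =>
    Projective.of_iso (e.app Q).symm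
      (adj₁.map_projective _ ((E.symm.map_projective_iff Q).2 hQ))
  let := HasExt.standard D
  have hext {X : D} {n : ℕ} (h : ExtVanishesAbove n (R.obj X)) : ExtVanishesAbove n X := by
    intro P hP j hj
    obtain ⟨j, rfl⟩ := Nat.exists_eq_succ_of_ne_zero (Nat.ne_zero_of_lt hj)
    have hQ : Projective (E.functor.obj (R.obj P)) :=
      (E.map_projective_iff _).2 (adj₂.map_projective P hP)
    refine ext_subsingleton_of_retract
      (Projective.factorThru (𝟙 P) (adj₁.counit.app P) ≫ hE.hom.app (R.obj P))
      (hE.inv.app (R.obj P) ≫ adj₁.counit.app P) (by simp) _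
      (subsingleton_ext_rightAdjoint_obj adj₂ _ j X (h _ hQ _ hj))
  have hres (X : D) (n : ℕ) : HasResDimLE IsGorensteinProjective X n ↔
      HasResDimLE IsGorensteinProjective (R.obj X) n :=
    ⟨fun h => h.map fun _ hY => hY.map adj₂ hCo,
      fun h => (hext h.extVanishesAbove).hasResDimLE hGorD⟩
  have hgdim (X : D) : gDim X = gDim (R.obj X) := by simp only [gDim, hres]
  exact ⟨hgdim, fun X => ⟨fun h => h.map adj₂ hCo,
    fun h => (hext h.extVanishesAbove).isGorensteinProjective hGorD⟩,
    fun d hd X => (hgdim X).trans (gDim_eq_projDim hGorC hd _)⟩
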